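/- Let n ≥ 2. For h > 0 define φ_h(z) = ∫_z^h ((h/t)^{2n} e^{2/t − 2/h} − 1)^{−1/2} dt for z ∈ (0, h]; note the integrand is well defined and the integral is finite. Then the family of graphs {(z, φ_h(z)) : 0 < z ≤ h}, h ∈ (0,∞), foliates the open quadrant (0,∞) × (0,∞): for every point (z₀, y₀) with z₀ > 0 and y₀ > 0 there exists exactly one h > z₀ such that φ_h(z₀) = y₀. In particular, for each fixed z₀ > 0 the map h ↦ φ_h(z₀) is a strictly increasing bijection from (z₀, ∞) onto (0, ∞). -/

import Mathlib

open Set Filter Topology intervalIntegral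

/-- The explicit grim-reaper profile of height `h`:
`φ_h(z) = ∫_z^h ((h/t)^{2n} e^{2/t − 2/h} − 1)^{−1/2} dt`. -/
noncomputable def grimProfile (n : ℕ) (h z : ℝ) : ℝ :=
  ∫ t in z..h, (Real.sqrt ((h / t) ^ (2 * n) * Real.exp (2 / t - 2 / h) - 1))⁻¹

/-- The integrand of the grim-reaper profile of height `h`. -/
noncomputable def grimIntegrand (n : ℕ) (h t : ℝ) : ℝ :=
  (Real.sqrt ((h / t) ^ (2 * n) * Real.exp (2 / t - 2 / h) - 1))⁻¹

/-- The grim-reaper integrand in the variable `s = t / h`, cut off below `z / h`. -/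
noncomputable def grimKernel (n : ℕ) (z h : ℝ) : ℝ → ℝ :=
  (Ioi (z / h)).indicator fun s => grimIntegrand n h (h * s)

/-- The integral of the cut-off kernel, equal to `φ_h(z) / h`. -/
noncomputable def scaledProfile (n : ℕ) (z h : ℝ) : ℝ :=
  ∫ s in (0 : ℝ)..1, grimKernel n z h s

theorem grimIntegrand_nonneg (n : ℕ) (h t : ℝ) : 0 ≤ grimIntegrand n h t := by
  unfold grimIntegrand; positivity

theorem measurable_grimIntegrand (n : ℕ) (h : ℝ) : Measurable (grimIntegrand n h) := by
  unfold grimIntegrand; fun_prop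

theorem grimIntegrand_mul {n : ℕ} {h s : ℝ} (hh : 0 < h) :
    grimIntegrand n h (h * s) =
      (Real.sqrt (s⁻¹ ^ (2 * n) * Real.exp (2 / h * (s⁻¹ - 1)) - 1))⁻¹ := by
  have h1 : h / (h * s) = s⁻¹ := by
    rw [div_mul_eq_div_div, div_self hh.ne', one_div]
  have h2 : 2 / (h * s) - 2 / h = 2 / h * (s⁻¹ - 1) := by
    rw [div_mul_eq_div_div, div_eq_mul_inv _ s]; ring
  rw [grimIntegrand, h1, h2]

theorem one_sub_le_radicand {n : ℕ} (hn : n ≠ 0) {h s : ℝ} (hh : 0 < h) (hs : s ∈ Ioo (0 : ℝ) 1) :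
    1 - s ≤ s⁻¹ ^ (2 * n) * Real.exp (2 / h * (s⁻¹ - 1)) - 1 := by
  obtain ⟨hs0, hs1⟩ := hs
  have hinv : 1 ≤ s⁻¹ := (one_le_inv₀ hs0).2 hs1.le
  have hpow : s⁻¹ ≤ s⁻¹ ^ (2 * n) := le_self_pow₀ hinv (by omega)
  have hexp : 1 ≤ Real.exp (2 / h * (s⁻¹ - 1)) :=
    Real.one_le_exp (mul_nonneg (by positivity) (by linarith))
  have hsum : 2 - s ≤ s⁻¹ := by
    rw [← one_div, le_div_iff₀ hs0]; nlinarith [sq_nonneg (s - 1)]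
  nlinarith

theorem grimIntegrand_mul_pos {n : ℕ} (hn : n ≠ 0) {h s : ℝ} (hh : 0 < h)
    (hs : s ∈ Ioo (0 : ℝ) 1) : 0 < grimIntegrand n h (h * s) := by
  rw [grimIntegrand_mul hh]
  have := one_sub_le_radicand hn hh hs
  exact inv_pos.2 (Real.sqrt_pos.2 (by linarith [hs.2]))

theorem grimIntegrand_mul_le {n : ℕ} (hn : n ≠ 0) {h s : ℝ} (hh : 0 < h)
    (hs : s ∈ Ioo (0 : ℝ) 1) : grimIntegrand n h (h * s) ≤ (Real.sqrt (1 - s))⁻¹ := by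
  rw [grimIntegrand_mul hh]
  exact inv_anti₀ (Real.sqrt_pos.2 (by linarith [hs.2]))
    (Real.sqrt_le_sqrt (one_sub_le_radicand hn hh hs))

theorem grimIntegrand_mul_mono {n : ℕ} (hn : n ≠ 0) {h k s : ℝ} (hh : 0 < h) (hk : h ≤ k)
    (hs : s ∈ Ioo (0 : ℝ) 1) : grimIntegrand n h (h * s) ≤ grimIntegrand n k (k * s) := by
  have hk0 : 0 < k := hh.trans_le hk
  rw [grimIntegrand_mul hh, grimIntegrand_mul hk0]
  have hpos := one_sub_le_radicand hn hk0 hs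
  have hs0 := hs.1
  have hinv : 0 ≤ s⁻¹ - 1 := sub_nonneg.2 ((one_le_inv₀ hs.1).2 hs.2.le)
  refine inv_anti₀ (Real.sqrt_pos.2 (by linarith [hs.2])) (Real.sqrt_le_sqrt ?_)
  gcongr

theorem continuousAt_grimIntegrand_mul {n : ℕ} (hn : n ≠ 0) {h s : ℝ} (hh : 0 < h)
    (hs : s ∈ Ioo (0 : ℝ) 1) : ContinuousAt (fun k => grimIntegrand n k (k * s)) h := by
  have hpos := one_sub_le_radicand hn hh hs
  have hev : (fun k => grimIntegrand n k (k * s)) =ᶠ[𝓝 h] fun k =>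
      (Real.sqrt (s⁻¹ ^ (2 * n) * Real.exp (2 / k * (s⁻¹ - 1)) - 1))⁻¹ := by
    filter_upwards [lt_mem_nhds hh] with k hk using grimIntegrand_mul hk
  refine ContinuousAt.congr ?_ hev.symm
  refine ContinuousAt.inv₀ ?_ (Real.sqrt_pos.2 (by linarith [hs.2])).ne'
  have : ContinuousAt (fun k : ℝ => 2 / k) h := continuousAt_const.div continuousAt_id hh.ne'
  fun_prop

theorem intervalIntegrable_inv_sqrt_one_sub :
    IntervalIntegrable (fun s : ℝ => (Real.sqrt (1 - s))⁻¹) MeasureTheory.volume 0 1 := by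
  have h := (intervalIntegrable_rpow' (a := 1) (b := 0) (r := -(1 / 2)) (by norm_num)).comp_sub_left 1
  norm_num only [sub_self, sub_zero] at h
  refine h.congr fun s hs => ?_
  rw [uIoc_of_le zero_le_one] at hs
  have : 0 ≤ 1 - s := by linarith [hs.2]
  simp only [Real.sqrt_eq_rpow, ← Real.rpow_neg this]

theorem ae_mem_Ioo_of_mem_uIoc :
    ∀ᵐ s : ℝ, s ∈ uIoc (0 : ℝ) 1 → s ∈ Ioo (0 : ℝ) 1 := by
  filter_upwards [MeasureTheory.Measure.ae_ne MeasureTheory.volume (1 : ℝ)] with s hs h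
  rw [uIoc_of_le zero_le_one] at h
  exact ⟨h.1, lt_of_le_of_ne h.2 hs⟩

theorem intervalIntegrable_grimIntegrand_mul {n : ℕ} (hn : n ≠ 0) {h : ℝ} (hh : 0 < h) :
    IntervalIntegrable (fun s => grimIntegrand n h (h * s)) MeasureTheory.volume 0 1 := by
  refine intervalIntegrable_inv_sqrt_one_sub.mono_fun'
    ((measurable_grimIntegrand n h).comp (measurable_const_mul h)).aestronglyMeasurable ?_
  rw [Filter.EventuallyLE, MeasureTheory.ae_restrict_iff' measurableSet_uIoc]
  filter_upwards [ae_mem_Ioo_of_mem_uIoc] with s hs h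
  rw [Real.norm_of_nonneg (grimIntegrand_nonneg ..)]
  exact grimIntegrand_mul_le hn hh (hs h)

theorem intervalIntegrable_grimIntegrand {n : ℕ} (hn : n ≠ 0) {h z : ℝ} (hz : z ∈ Ioc 0 h) :
    IntervalIntegrable (grimIntegrand n h) MeasureTheory.volume z h := by
  have hh : 0 < h := hz.1.trans_le hz.2
  have h1 := (intervalIntegrable_grimIntegrand_mul hn hh).comp_mul_left (c := h⁻¹)
  simp only [mul_inv_cancel_left₀ hh.ne', zero_div, one_div, inv_inv] at h1
  refine h1.mono_set ?_
  rw [uIcc_of_le hz.2, uIcc_of_le hh.le]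
  exact Icc_subset_Icc_left hz.1.le

theorem measurable_grimKernel (n : ℕ) (z h : ℝ) : Measurable (grimKernel n z h) :=
  ((measurable_grimIntegrand n h).comp (measurable_const_mul h)).indicator measurableSet_Ioi

theorem grimKernel_nonneg (n : ℕ) (z h s : ℝ) : 0 ≤ grimKernel n z h s :=
  indicator_nonneg (fun _ _ => grimIntegrand_nonneg ..) s

theorem grimKernel_le {n : ℕ} (hn : n ≠ 0) {z h s : ℝ} (hh : 0 < h) (hs : s ∈ Ioo (0 : ℝ) 1) :
    grimKernel n z h s ≤ (Real.sqrt (1 - s))⁻¹ :=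
  (indicator_le_self' (fun _ _ => grimIntegrand_nonneg ..) s).trans (grimIntegrand_mul_le hn hh hs)

theorem intervalIntegrable_grimKernel {n : ℕ} (hn : n ≠ 0) (z : ℝ) {h : ℝ} (hh : 0 < h) :
    IntervalIntegrable (grimKernel n z h) MeasureTheory.volume 0 1 := by
  refine intervalIntegrable_inv_sqrt_one_sub.mono_fun'
    (measurable_grimKernel n z h).aestronglyMeasurable ?_
  rw [Filter.EventuallyLE, MeasureTheory.ae_restrict_iff' measurableSet_uIoc]
  filter_upwards [ae_mem_Ioo_of_mem_uIoc] with s hs h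
  rw [Real.norm_of_nonneg (grimKernel_nonneg ..)]
  exact grimKernel_le hn hh (hs h)

theorem scaledProfile_eq {n : ℕ} {z h : ℝ} (hz : 0 < z) (hh : z ≤ h) :
    scaledProfile n z h = ∫ s in z / h..1, grimIntegrand n h (h * s) := by
  have h0 : 0 < h := hz.trans_le hh
  rw [scaledProfile, integral_of_le zero_le_one, integral_of_le ((div_le_one h0).2 hh),
    grimKernel, MeasureTheory.setIntegral_indicator measurableSet_Ioi, Ioc_inter_Ioi,
    sup_of_le_right (by positivity)]

theorem grimProfile_eq {n : ℕ} {z h : ℝ} (hz : 0 < z) (hh : z ≤ h) :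
    grimProfile n h z = h * scaledProfile n z h := by
  have h0 : 0 < h := hz.trans_le hh
  rw [scaledProfile_eq hz hh, intervalIntegral.integral_comp_mul_left _ h0.ne',
    mul_div_cancel₀ _ h0.ne', mul_one, smul_eq_mul, mul_inv_cancel_left₀ h0.ne']
  rfl

theorem scaledProfile_pos {n : ℕ} (hn : n ≠ 0) {z h : ℝ} (hz : 0 < z) (hh : z < h) :
    0 < scaledProfile n z h := by
  have h0 : 0 < h := hz.trans hh
  have hzh : z / h < 1 := (div_lt_one h0).2 hh
  rw [scaledProfile_eq hz hh.le]
  refine intervalIntegral_pos_of_pos_on ((intervalIntegrable_grimIntegrand_mul hn h0).mono_set ?_)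
    (fun s hs => grimIntegrand_mul_pos hn h0 ⟨(by positivity : 0 < z / h).trans hs.1, hs.2⟩) hzh
  rw [uIcc_of_le hzh.le, uIcc_of_le zero_le_one]
  exact Icc_subset_Icc_left (by positivity)

theorem scaledProfile_mono {n : ℕ} (hn : n ≠ 0) {z h k : ℝ} (hz : 0 < z) (hh : z ≤ h)
    (hk : h ≤ k) : scaledProfile n z h ≤ scaledProfile n z k := by
  have h0 : 0 < h := hz.trans_le hh
  refine integral_mono_on_of_le_Ioo zero_le_one (intervalIntegrable_grimKernel hn z h0)
    (intervalIntegrable_grimKernel hn z (h0.trans_le hk)) fun s hs => ?_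
  by_cases hzs : z / h < s
  · have hzs' : z / k < s := (by gcongr : z / k ≤ z / h).trans_lt hzs
    rw [grimKernel, grimKernel, indicator_of_mem (mem_Ioi.2 hzs), indicator_of_mem (mem_Ioi.2 hzs')]
    exact grimIntegrand_mul_mono hn h0 hk hs
  · rw [grimKernel, indicator_of_notMem (by simpa using hzs)]
    exact grimKernel_nonneg ..

theorem continuousAt_grimKernel {n : ℕ} (hn : n ≠ 0) {z h s : ℝ} (hh : 0 < h)
    (hs : s ∈ Ioo (0 : ℝ) 1) (hne : s ≠ z / h) : ContinuousAt (fun k => grimKernel n z k s) h := by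
  have hdiv : ContinuousAt (fun k => z / k) h := continuousAt_const.div continuousAt_id hh.ne'
  rcases hne.lt_or_gt with hlt | hgt
  · refine (continuousAt_const (y := (0 : ℝ))).congr ?_
    filter_upwards [hdiv.eventually (lt_mem_nhds hlt)] with k hk
    exact (indicator_of_notMem (by simpa using hk.le) _).symm
  · refine (continuousAt_grimIntegrand_mul hn hh hs).congr ?_
    filter_upwards [hdiv.eventually (gt_mem_nhds hgt)] with k hk
    exact (indicator_of_mem (mem_Ioi.2 hk) fun s => grimIntegrand n k (k * s)).symm

theorem continuousAt_scaledProfile {n : ℕ} (hn : n ≠ 0) (z : ℝ) {h : ℝ} (hh : 0 < h) :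
    ContinuousAt (scaledProfile n z) h := by
  refine continuousAt_of_dominated_interval (bound := fun s => (Real.sqrt (1 - s))⁻¹)
    (.of_forall fun k => (measurable_grimKernel n z k).aestronglyMeasurable) ?_
    intervalIntegrable_inv_sqrt_one_sub ?_
  · filter_upwards [lt_mem_nhds hh] with k hk
    filter_upwards [ae_mem_Ioo_of_mem_uIoc] with s hs hs'
    rw [Real.norm_of_nonneg (grimKernel_nonneg ..)]
    exact grimKernel_le hn hk (hs hs')
  · filter_upwards [ae_mem_Ioo_of_mem_uIoc,
      MeasureTheory.Measure.ae_ne MeasureTheory.volume (z / h)] with s hs hne hs'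
    exact continuousAt_grimKernel hn hh (hs hs') hne

theorem strictMonoOn_grimProfile {n : ℕ} (hn : n ≠ 0) {z : ℝ} (hz : 0 < z) :
    StrictMonoOn (fun h => grimProfile n h z) (Ioi z) := by
  intro h hh k hk hhk
  have hh' : z < h := hh
  simp only [grimProfile_eq hz hh'.le, grimProfile_eq hz (hh'.trans hhk).le]
  exact mul_lt_mul hhk (scaledProfile_mono hn hz hh'.le hhk.le) (scaledProfile_pos hn hz hh')
    (hz.trans (hh'.trans hhk)).le

theorem surjOn_grimProfile {n : ℕ} (hn : n ≠ 0) {z : ℝ} (hz : 0 < z) :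
    SurjOn (fun h => grimProfile n h z) (Ioi z) (Ioi 0) := by
  intro y hy
  have hy : 0 < y := hy
  have hz2 : z < 2 * z := by linarith
  have hc := scaledProfile_pos hn hz hz2
  set c := scaledProfile n z (2 * z)
  set b := max (2 * z) (y / c)
  have hzb : 2 * z ≤ b := le_max_left ..
  have hb : y ≤ b * scaledProfile n z b :=
    calc y = y / c * c := (div_mul_cancel₀ _ hc.ne').symm
      _ ≤ b * scaledProfile n z b := by
        gcongr
        · exact le_max_right ..
        · exact scaledProfile_mono hn hz hz2.le hzb
  have hcont : ContinuousOn (fun h => h * scaledProfile n z h) (Icc z b) := fun h hh =>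
    (continuousAt_id.mul
      (continuousAt_scaledProfile hn z (hz.trans_le hh.1))).continuousWithinAt
  have hzero : z * scaledProfile n z z = 0 := by
    rw [scaledProfile_eq hz le_rfl, div_self hz.ne', integral_same, mul_zero]
  obtain ⟨h, hh, rfl⟩ := intermediate_value_Icc (hz2.le.trans hzb) hcont
    (show y ∈ Icc _ _ from ⟨hzero.le.trans hy.le, hb⟩)
  have hne : z ≠ h := by
    rintro rfl
    exact hy.ne' hzero
  exact ⟨h, lt_of_le_of_ne hh.1 hne, grimProfile_eq hz hh.1⟩

theorem bijOn_grimProfile {n : ℕ} (hn : n ≠ 0) {z : ℝ} (hz : 0 < z) :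
    BijOn (fun h => grimProfile n h z) (Ioi z) (Ioi 0) := by
  refine ⟨fun h hh => ?_, (strictMonoOn_grimProfile hn hz).injOn, surjOn_grimProfile hn hz⟩
  have hh' : z < h := hh
  simp only [grimProfile_eq hz hh'.le, mem_Ioi]
  exact mul_pos (hz.trans hh') (scaledProfile_pos hn hz hh')

/-- the integrand defining `φ_h` is interval integrable on `(z,h)`, and
the graphs of the profiles `φ_h`, `h ∈ (0,∞)`, foliate the open quadrant: for every
`(z₀,y₀)` with `z₀,y₀ > 0` there is exactly one `h > z₀` with `φ_h(z₀) = y₀`; in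
particular for each `z₀ > 0` the map `h ↦ φ_h(z₀)` is a strictly increasing bijection
from `(z₀,∞)` onto `(0,∞)`. -/
theorem grim_reaper_foliation (n : ℕ) (hn : 2 ≤ n) :
    (∀ h : ℝ, 0 < h → ∀ z ∈ Set.Ioc (0 : ℝ) h,
      IntervalIntegrable
        (fun t => (Real.sqrt ((h / t) ^ (2 * n) * Real.exp (2 / t - 2 / h) - 1))⁻¹)
        MeasureTheory.volume z h) ∧
    (∀ z₀ y₀ : ℝ, 0 < z₀ → 0 < y₀ →
      ∃! h : ℝ, z₀ < h ∧ grimProfile n h z₀ = y₀) ∧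
    (∀ z₀ : ℝ, 0 < z₀ →
      StrictMonoOn (fun h => grimProfile n h z₀) (Set.Ioi z₀) ∧
      Set.BijOn (fun h => grimProfile n h z₀) (Set.Ioi z₀) (Set.Ioi 0)) := by
  have hn0 : n ≠ 0 := by omega
  refine ⟨fun h _ z hz => intervalIntegrable_grimIntegrand hn0 hz, fun z y hz hy => ?_,
    fun z hz => ⟨strictMonoOn_grimProfile hn0 hz, bijOn_grimProfile hn0 hz⟩⟩
  obtain ⟨h, hh, rfl⟩ := surjOn_grimProfile hn0 hz (mem_Ioi.2 hy)
  exact ⟨h, ⟨hh, rfl⟩, fun k hk => (strictMonoOn_grimProfile hn0 hz).injOn hk.1 hh hk.2⟩
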